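/- Let C be a finitary extensive category with finite products and let T = (T, η, μ) be a monad on C equipped with an associative binary operation, i.e. a family of morphisms c_X : X ⨯ X ⟶ T X natural in X satisfying μ_X ∘ c_{T X} ∘ (c_X ⨯ η_X) = μ_X ∘ c_{T X} ∘ (η_X ⨯ c_X) ∘ α_{X,X,X}, where α_{X,X,X} : (X ⨯ X) ⨯ X ≅ X ⨯ (X ⨯ X) is the associator. Then for any comonad D = (D, ε, δ) on C and any monad-comonad interaction law ψ of T and D, the following two equations hold for all objects X and Y: (1) ψ_{X,Y} ∘ ((μ_X ∘ c_{T X} ∘ (c_X ⨯ η_X)) ⨯ id_{D Y}) = ψ_{X,Y} ∘ (c_X ⨯ id_{D Y}) ∘ ((fst ⨯ id_X) ⨯ id_{D Y}) as morphisms ((X ⨯ X) ⨯ X) ⨯ D Y ⟶ X ⨯ Y (i.e. interacting the left-nested triple equals interacting the pair of the outermost components), and (2) ψ_{X,Y} ∘ ((μ_X ∘ c_{T X} ∘ (η_X ⨯ c_X)) ⨯ id_{D Y}) = ψ_{X,Y} ∘ (c_X ⨯ id_{D Y}) ∘ ((id_X ⨯ snd) ⨯ id_{D Y}) as morphisms (X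 ⨯ (X ⨯ X)) ⨯ D Y ⟶ X ⨯ Y. -/

import Mathlib

open CategoryTheory CategoryTheory.Limits

universe v u

/-- Parallel morphisms out of `Γ` agree as soon as they agree on the two parts of a decomposition
of `Γ` given by a morphism to `(⊤_ C) ⨿ (⊤_ C)`. -/
theorem hom_ext_of_coprod_terminal {C : Type u} [Category.{v} C] [FinitaryExtensive C]
    [HasTerminal C] {Γ Z : C} (h : Γ ⟶ (⊤_ C) ⨿ (⊤_ C)) {f g : Γ ⟶ Z}
    (hl : ∀ {Δ : C} (u : Δ ⟶ Γ), u ≫ h = terminal.from Δ ≫ coprod.inl → u ≫ f = u ≫ g)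
    (hr : ∀ {Δ : C} (u : Δ ⟶ Γ), u ≫ h = terminal.from Δ ≫ coprod.inr → u ≫ f = u ≫ g) :
    f = g := by
  have pl := IsPullback.of_hasPullback h (coprod.inl : ⊤_ C ⟶ (⊤_ C) ⨿ (⊤_ C))
  have pr := IsPullback.of_hasPullback h (coprod.inr : ⊤_ C ⟶ (⊤_ C) ⨿ (⊤_ C))
  obtain ⟨hc⟩ := ((BinaryCofan.isVanKampen_iff _).mp
    (FinitaryExtensive.vanKampen _ (coprodIsCoprod (⊤_ C) (⊤_ C)))
    (BinaryCofan.mk _ _) _ _ h pl.w.symm pr.w.symm).mpr ⟨pl, pr⟩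
  refine BinaryCofan.IsColimit.hom_ext hc (hl _ ?_) (hr _ ?_)
  · exact pl.w.trans (congrArg (· ≫ _) (Subsingleton.elim _ _))
  · exact pr.w.trans (congrArg (· ≫ _) (Subsingleton.elim _ _))

theorem exists_factor_coprod_inl {C : Type u} [Category.{v} C] [FinitaryExtensive C]
    [HasTerminal C] {Γ A B : C} (w : Γ ⟶ A ⨿ B)
    (hw : w ≫ coprod.map (terminal.from A) (terminal.from B) = terminal.from Γ ≫ coprod.inl) :
    ∃ w' : Γ ⟶ A, w = w' ≫ coprod.inl := by
  have hp := (((BinaryCofan.isVanKampen_iff _).mp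
    (FinitaryExtensive.vanKampen _ (coprodIsCoprod (⊤_ C) (⊤_ C)))
    (BinaryCofan.mk (coprod.inl : A ⟶ A ⨿ B) coprod.inr) (terminal.from A) (terminal.from B)
    (coprod.map (terminal.from A) (terminal.from B))
    (coprod.inl_map _ _).symm (coprod.inr_map _ _).symm).mp ⟨coprodIsCoprod A B⟩).1
  exact ⟨hp.lift w (terminal.from Γ) hw, (hp.lift_fst _ _ _).symm⟩

theorem exists_factor_coprod_inr {C : Type u} [Category.{v} C] [FinitaryExtensive C]
    [HasTerminal C] {Γ A B : C} (w : Γ ⟶ A ⨿ B)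
    (hw : w ≫ coprod.map (terminal.from A) (terminal.from B) = terminal.from Γ ≫ coprod.inr) :
    ∃ w' : Γ ⟶ B, w = w' ≫ coprod.inr := by
  have hp := (((BinaryCofan.isVanKampen_iff _).mp
    (FinitaryExtensive.vanKampen _ (coprodIsCoprod (⊤_ C) (⊤_ C)))
    (BinaryCofan.mk (coprod.inl : A ⟶ A ⨿ B) coprod.inr) (terminal.from A) (terminal.from B)
    (coprod.map (terminal.from A) (terminal.from B))
    (coprod.inl_map _ _).symm (coprod.inr_map _ _).symm).mp ⟨coprodIsCoprod A B⟩).2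
  exact ⟨hp.lift w (terminal.from Γ) hw, (hp.lift_fst _ _ _).symm⟩

section Choice

variable {C : Type u} [Category.{v} C] [HasFiniteProducts C]
  {F G : C ⥤ C} (ψ : ∀ X Y : C, F.obj X ⨯ G.obj Y ⟶ X ⨯ Y) (c : ∀ X : C, X ⨯ X ⟶ F.obj X)

/-- The result of interacting the pair `(x, y)` with `d`, on generalized elements. -/
noncomputable def interactPair {Γ X Y : C} (x y : Γ ⟶ X) (d : Γ ⟶ G.obj Y) : Γ ⟶ X ⨯ Y :=
  prod.lift (prod.lift x y ≫ c X) d ≫ ψ X Y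

/-- The component of a pair which is selected when interacting with `d`. -/
noncomputable def selector [HasBinaryCoproducts C] {Γ Y : C} (d : Γ ⟶ G.obj Y) :
    Γ ⟶ (⊤_ C) ⨿ (⊤_ C) :=
  interactPair ψ c (terminal.from Γ ≫ coprod.inl) (terminal.from Γ ≫ coprod.inr)
    (d ≫ G.map (terminal.from Y)) ≫ prod.fst

theorem comp_interactPair {Γ Δ X Y : C} (u : Δ ⟶ Γ) (x y : Γ ⟶ X) (d : Γ ⟶ G.obj Y) :
    u ≫ interactPair ψ c x y d = interactPair ψ c (u ≫ x) (u ≫ y) (u ≫ d) := by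
  simp only [interactPair, ← Category.assoc, prod.comp_lift]

theorem comp_selector [HasBinaryCoproducts C] {Γ Δ Y : C} (u : Δ ⟶ Γ) (d : Γ ⟶ G.obj Y) :
    u ≫ selector ψ c d = selector ψ c (u ≫ d) := by
  simp only [selector, ← Category.assoc, comp_interactPair, terminal.comp_from]

theorem selector_comp_map [HasBinaryCoproducts C] {Γ Y Y' : C} (d : Γ ⟶ G.obj Y) (g : Y ⟶ Y') :
    selector ψ c (d ≫ G.map g) = selector ψ c d := by
  simp only [selector, Category.assoc, ← G.map_comp, terminal.comp_from]

variable {ψ c}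

theorem interactPair_naturality
    (ψ_nat : ∀ {X X' Y Y' : C} (f : X ⟶ X') (g : Y ⟶ Y'),
      prod.map (F.map f) (G.map g) ≫ ψ X' Y' = ψ X Y ≫ prod.map f g)
    (c_nat : ∀ {X X' : C} (f : X ⟶ X'), prod.map f f ≫ c X' = c X ≫ F.map f)
    {Γ X X' Y Y' : C} (x y : Γ ⟶ X) (d : Γ ⟶ G.obj Y)
    (f : X ⟶ X') (g : Y ⟶ Y') :
    interactPair ψ c (x ≫ f) (y ≫ f) (d ≫ G.map g) =
      interactPair ψ c x y d ≫ prod.map f g := by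
  simp only [interactPair, Category.assoc, ← ψ_nat, prod.lift_map_assoc, ← c_nat]

theorem interactPair_eq_of_generic [HasBinaryCoproducts C]
    (ψ_nat : ∀ {X X' Y Y' : C} (f : X ⟶ X') (g : Y ⟶ Y'),
      prod.map (F.map f) (G.map g) ≫ ψ X' Y' = ψ X Y ≫ prod.map f g)
    (c_nat : ∀ {X X' : C} (f : X ⟶ X'), prod.map f f ≫ c X' = c X ≫ F.map f)
    {Γ X Y : C} (x y : Γ ⟶ X) (d : Γ ⟶ G.obj Y) :
    interactPair ψ c x y d =
      interactPair ψ c (coprod.inl : Γ ⟶ Γ ⨿ Γ) coprod.inr d ≫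
        prod.map (coprod.desc x y) (𝟙 Y) := by
  rw [← interactPair_naturality ψ_nat c_nat, coprod.inl_desc, coprod.inr_desc, G.map_id,
    Category.comp_id]

theorem interactPair_generic_fst [HasBinaryCoproducts C]
    (ψ_nat : ∀ {X X' Y Y' : C} (f : X ⟶ X') (g : Y ⟶ Y'),
      prod.map (F.map f) (G.map g) ≫ ψ X' Y' = ψ X Y ≫ prod.map f g)
    (c_nat : ∀ {X X' : C} (f : X ⟶ X'), prod.map f f ≫ c X' = c X ≫ F.map f)
    {Γ Y : C} (d : Γ ⟶ G.obj Y) :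
    (interactPair ψ c (coprod.inl : Γ ⟶ Γ ⨿ Γ) coprod.inr d ≫ prod.fst) ≫
      coprod.map (terminal.from Γ) (terminal.from Γ) = selector ψ c d := by
  rw [selector, ← coprod.inl_map (terminal.from Γ) (terminal.from Γ),
    ← coprod.inr_map (terminal.from Γ) (terminal.from Γ),
    interactPair_naturality ψ_nat c_nat]
  simp

theorem interactPair_congr_right [FinitaryExtensive C]
    (ψ_nat : ∀ {X X' Y Y' : C} (f : X ⟶ X') (g : Y ⟶ Y'),
      prod.map (F.map f) (G.map g) ≫ ψ X' Y' = ψ X Y ≫ prod.map f g)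
    (c_nat : ∀ {X X' : C} (f : X ⟶ X'), prod.map f f ≫ c X' = c X ≫ F.map f)
    {Γ X Y : C} (x y y' : Γ ⟶ X) (d : Γ ⟶ G.obj Y)
    (hd : selector ψ c d = terminal.from Γ ≫ coprod.inl) :
    interactPair ψ c x y d = interactPair ψ c x y' d := by
  obtain ⟨w, hw⟩ := exists_factor_coprod_inl _
    ((interactPair_generic_fst ψ_nat c_nat d).trans hd)
  rw [interactPair_eq_of_generic ψ_nat c_nat x y,
    interactPair_eq_of_generic ψ_nat c_nat x y']
  ext <;> simp [reassoc_of% hw, coprod.inl_desc]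

theorem interactPair_congr_left [FinitaryExtensive C]
    (ψ_nat : ∀ {X X' Y Y' : C} (f : X ⟶ X') (g : Y ⟶ Y'),
      prod.map (F.map f) (G.map g) ≫ ψ X' Y' = ψ X Y ≫ prod.map f g)
    (c_nat : ∀ {X X' : C} (f : X ⟶ X'), prod.map f f ≫ c X' = c X ≫ F.map f)
    {Γ X Y : C} (x x' y : Γ ⟶ X) (d : Γ ⟶ G.obj Y)
    (hd : selector ψ c d = terminal.from Γ ≫ coprod.inr) :
    interactPair ψ c x y d = interactPair ψ c x' y d := by
  obtain ⟨w, hw⟩ := exists_factor_coprod_inr _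
    ((interactPair_generic_fst ψ_nat c_nat d).trans hd)
  rw [interactPair_eq_of_generic ψ_nat c_nat x y,
    interactPair_eq_of_generic ψ_nat c_nat x' y]
  ext <;> simp [reassoc_of% hw, coprod.inr_desc]

end Choice

theorem lift_lift_comp_assoc {C : Type u} [Category.{v} C] [HasFiniteProducts C]
    {T : Monad C} {c : ∀ X : C, X ⨯ X ⟶ T.obj X}
    (c_assoc : ∀ X : C,
      prod.map (c X) (T.η.app X) ≫ c (T.obj X) ≫ T.μ.app X =
        (prod.associator X X X).hom ≫ prod.map (T.η.app X) (c X) ≫ c (T.obj X) ≫ T.μ.app X)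
    {Γ X : C} (x y z : Γ ⟶ X) :
    prod.lift (prod.lift x y ≫ c X) (z ≫ T.η.app X) ≫ c (T.obj X) ≫ T.μ.app X =
      prod.lift (x ≫ T.η.app X) (prod.lift y z ≫ c X) ≫ c (T.obj X) ≫ T.μ.app X := by
  have := prod.lift (prod.lift x y) z ≫= c_assoc X
  simpa [prod.comp_lift_assoc, prod.lift_fst_assoc, prod.lift_snd_assoc, prod.lift_snd]
    using this

/-- A triple of generalized elements, associated to the left, interacts like the pair of its
outermost components. -/
theorem interact_triple {C : Type u} [Category.{v} C] [FinitaryExtensive C] [HasFiniteProducts C]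
    {T : Monad C} {D : Comonad C}
    {ψ : ∀ X Y : C, T.obj X ⨯ D.obj Y ⟶ X ⨯ Y}
    (ψ_nat : ∀ {X X' Y Y' : C} (f : X ⟶ X') (g : Y ⟶ Y'),
      prod.map (T.map f) (D.map g) ≫ ψ X' Y' = ψ X Y ≫ prod.map f g)
    (ψ_mult : ∀ X Y : C,
      prod.map (T.μ.app X) (𝟙 (D.obj Y)) ≫ ψ X Y =
        prod.map (𝟙 (T.obj (T.obj X))) (D.δ.app Y) ≫ ψ (T.obj X) (D.obj Y) ≫ ψ X Y)
    {c : ∀ X : C, X ⨯ X ⟶ T.obj X}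
    (c_nat : ∀ {X X' : C} (f : X ⟶ X'), prod.map f f ≫ c X' = c X ≫ T.map f)
    (c_assoc : ∀ X : C,
      prod.map (c X) (T.η.app X) ≫ c (T.obj X) ≫ T.μ.app X =
        (prod.associator X X X).hom ≫ prod.map (T.η.app X) (c X) ≫ c (T.obj X) ≫ T.μ.app X)
    {Γ X Y : C} (x y z : Γ ⟶ X) (d : Γ ⟶ D.obj Y) :
    prod.lift (prod.lift (prod.lift x y ≫ c X) (z ≫ T.η.app X) ≫ c (T.obj X) ≫ T.μ.app X) d ≫
        ψ X Y = prod.lift (prod.lift x z ≫ c X) d ≫ ψ X Y := by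
  have key {Δ : C} (p q : Δ ⟶ T.obj X) (d : Δ ⟶ D.obj Y) :
      prod.lift (prod.lift p q ≫ c (T.obj X) ≫ T.μ.app X) d ≫ ψ X Y =
        interactPair ψ c p q (d ≫ D.δ.app Y) ≫ ψ X Y := by
    have := prod.lift (prod.lift p q ≫ c (T.obj X)) d ≫= ψ_mult X Y
    simpa [interactPair] using this
  have sel {Δ : C} (d : Δ ⟶ D.obj Y) :
      selector ψ c (d ≫ D.δ.app Y) = selector ψ c d := by
    rw [← selector_comp_map ψ c (d ≫ D.δ.app Y) (D.ε.app Y)]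
    simp
  have unit {Δ : C} (x z : Δ ⟶ X) :
      prod.lift x z ≫ c X =
        prod.lift (x ≫ T.η.app X) (z ≫ T.η.app X) ≫ c (T.obj X) ≫ T.μ.app X := by
    have := prod.lift x z ≫= c_nat (T.η.app X) =≫ T.μ.app X
    simpa using this.symm
  refine hom_ext_of_coprod_terminal (selector ψ c d) (fun u hu => ?_) (fun u hu => ?_)
  · rw [comp_selector, ← sel] at hu
    rw [lift_lift_comp_assoc c_assoc, unit x z, key, key, ← Category.assoc, ← Category.assoc,
      comp_interactPair, comp_interactPair, ← Category.assoc u d]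
    exact congrArg (· ≫ _) (interactPair_congr_right ψ_nat c_nat _ _ _ _ hu)
  · rw [comp_selector, ← sel] at hu
    rw [unit x z, key, key, ← Category.assoc, ← Category.assoc, comp_interactPair,
      comp_interactPair, ← Category.assoc u d]
    exact congrArg (· ≫ _) (interactPair_congr_left ψ_nat c_nat _ _ _ _ hu)

theorem map_map_comp_map_id {C : Type u} [Category.{v} C] [HasFiniteProducts C]
    {A A' B B' E W Z : C} (f : A ⟶ A') (g : B ⟶ B') (m : A' ⨯ B' ⟶ E) (k : E ⨯ W ⟶ Z) :
    prod.map (prod.map f g ≫ m) (𝟙 W) ≫ k =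
      prod.lift (prod.lift ((prod.fst ≫ prod.fst) ≫ f) ((prod.fst ≫ prod.snd) ≫ g) ≫ m)
        prod.snd ≫ k := by
  congr 1
  ext
  · simp only [prod.map_fst, prod.lift_fst, ← Category.assoc]
    congr 1
    ext <;> simp [prod.lift_fst, prod.lift_snd]
  · simp [prod.lift_snd]

/-- If a monad `T` on a finitary extensive category with finite products has an associative
binary operation `c`, then for any comonad `D` and any monad-comonad interaction law `ψ`,
interacting a left-nested (resp. right-nested) triple equals interacting the pair of the
outermost components. -/
theorem stmt_2 {C : Type u} [Category.{v} C] [FinitaryExtensive C] [HasFiniteProducts C]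
    (T : Monad C) (D : Comonad C)
    (ψ : ∀ X Y : C, T.obj X ⨯ D.obj Y ⟶ X ⨯ Y)
    (ψ_nat : ∀ {X X' Y Y' : C} (f : X ⟶ X') (g : Y ⟶ Y'),
      prod.map (T.map f) (D.map g) ≫ ψ X' Y' = ψ X Y ≫ prod.map f g)
    (ψ_unit : ∀ X Y : C,
      prod.map (T.η.app X) (𝟙 (D.obj Y)) ≫ ψ X Y = prod.map (𝟙 X) (D.ε.app Y))
    (ψ_mult : ∀ X Y : C,
      prod.map (T.μ.app X) (𝟙 (D.obj Y)) ≫ ψ X Y =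
        prod.map (𝟙 (T.obj (T.obj X))) (D.δ.app Y) ≫ ψ (T.obj X) (D.obj Y) ≫ ψ X Y)
    (c : ∀ X : C, X ⨯ X ⟶ T.obj X)
    (c_nat : ∀ {X X' : C} (f : X ⟶ X'), prod.map f f ≫ c X' = c X ≫ T.map f)
    (c_assoc : ∀ X : C,
      prod.map (c X) (T.η.app X) ≫ c (T.obj X) ≫ T.μ.app X =
        (prod.associator X X X).hom ≫ prod.map (T.η.app X) (c X) ≫ c (T.obj X) ≫ T.μ.app X) :
    ∀ X Y : C,
      (prod.map (prod.map (c X) (T.η.app X) ≫ c (T.obj X) ≫ T.μ.app X) (𝟙 (D.obj Y)) ≫ ψ X Y =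
        prod.map (prod.map prod.fst (𝟙 X)) (𝟙 (D.obj Y)) ≫
          prod.map (c X) (𝟙 (D.obj Y)) ≫ ψ X Y) ∧
      (prod.map (prod.map (T.η.app X) (c X) ≫ c (T.obj X) ≫ T.μ.app X) (𝟙 (D.obj Y)) ≫ ψ X Y =
        prod.map (prod.map (𝟙 X) prod.snd) (𝟙 (D.obj Y)) ≫
          prod.map (c X) (𝟙 (D.obj Y)) ≫ ψ X Y) := by
  intro X Y
  constructor
  · let p : ((X ⨯ X) ⨯ X) ⨯ D.obj Y ⟶ X ⨯ X := prod.fst ≫ prod.fst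
    have h := interact_triple ψ_nat ψ_mult c_nat c_assoc (p ≫ prod.fst) (p ≫ prod.snd)
      (prod.fst ≫ prod.snd) prod.snd
    rw [← prod.comp_lift, prod.lift_fst_snd, Category.comp_id] at h
    refine (map_map_comp_map_id (c X) (T.η.app X) _ _).trans (h.trans ?_)
    rw [prod.map_map_assoc, Category.comp_id, map_map_comp_map_id, Category.comp_id]
  · let q : (X ⨯ (X ⨯ X)) ⨯ D.obj Y ⟶ X ⨯ X := prod.fst ≫ prod.snd
    have h := interact_triple ψ_nat ψ_mult c_nat c_assoc (prod.fst ≫ prod.fst) (q ≫ prod.fst)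
      (q ≫ prod.snd) prod.snd
    rw [lift_lift_comp_assoc c_assoc, ← prod.comp_lift, prod.lift_fst_snd, Category.comp_id] at h
    refine (map_map_comp_map_id (T.η.app X) (c X) _ _).trans (h.trans ?_)
    rw [prod.map_map_assoc, Category.comp_id, map_map_comp_map_id, Category.comp_id]
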